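/- Let μ be a probability measure on ℝ^d, f* : ℝ^d → ℝ a differentiable target function, and f(x, W) = f̃(W₁x, W₂) a differentiable model. Let x₁, …, xₙ ∈ ℝ^d be nonzero training points and W* = (W₁*, W₂*) an interpolation solution: f(xᵢ, W*) = f*(xᵢ) for all i. Assume: (i) for every parameter coordinate j, (1/n) Σᵢ (∂f/∂W_j(xᵢ, W*))^{2k} ≤ 2^k B^{k−1}/η^k; (ii) f satisfies the (C, δ_approx, k)-local smoothness condition at each (xᵢ, W*) with δ_approx ≥ δ ‖W₁*‖₂ / minᵢ ‖xᵢ‖₂; (iii) μ({x : minᵢ ‖x − xᵢ‖₂ > δ}) < ε₂; (iv) |f(x, W*)| ≤ M₁ and |f*(x)| ≤ M₁ for all x, and ‖∇f*(x)‖₂ ≤ M₂ for all x. Then ∫ (f(x, W*) − f*(x))² dμ(x) ≤ (2dC² ‖(W₁*)ᵀ‖_{2k}² / minᵢ ‖xᵢ‖_{2k}²) · ((2nw/B)^{1/(2k)} √(2B/η) + 1)² δ² + 2M₂² δ² + 4M₁² ε₂, where w is the number of parameters. -/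

import Mathlib

open MeasureTheory

/-- Matrix–vector product of `W : ℝ^{m×d}` (as a function) with `x : ℝ^d`. -/
noncomputable def mVec {m d : ℕ} (W : Fin m → Fin d → ℝ) (x : Fin d → ℝ) : Fin m → ℝ :=
  fun r => ∑ s, W r s * x s

/-- Euclidean (ℓ²) norm of a vector in `ℝ^d`. -/
noncomputable def l2norm {d : ℕ} (v : Fin d → ℝ) : ℝ := Real.sqrt (∑ j, v j ^ 2)

/-- Operator norm of a matrix induced by Euclidean norms. -/
noncomputable def opNorm2 {m d : ℕ} (W : Fin m → Fin d → ℝ) : ℝ :=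
  sSup {r : ℝ | ∃ x : Fin d → ℝ, l2norm x = 1 ∧ r = l2norm (mVec W x)}

/-- ℓ^{2k} norm of a vector. -/
noncomputable def lpnorm (k : ℕ) {d : ℕ} (v : Fin d → ℝ) : ℝ :=
  (∑ j, |v j| ^ (2 * k)) ^ ((2 * k : ℝ))⁻¹

/-- Operator norm of a matrix induced by ℓ^{2k} norms on domain and codomain. -/
noncomputable def opNormP (k : ℕ) {m d : ℕ} (W : Fin m → Fin d → ℝ) : ℝ :=
  sSup {r : ℝ | ∃ x : Fin d → ℝ, lpnorm k x = 1 ∧ r = lpnorm k (mVec W x)}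

/-- Euclidean distance between two (flattened) parameter pairs `W = (W₁, W₂)`. -/
noncomputable def paramDist {m d p : ℕ}
    (W W' : (Fin m → Fin d → ℝ) × (Fin p → ℝ)) : ℝ :=
  Real.sqrt ((∑ r, ∑ s, (W.1 r s - W'.1 r s) ^ 2) + ∑ l, (W.2 l - W'.2 l) ^ 2)

/-- The ℓ^{2k} norm `‖∇_W F‖_{2k}` of the gradient of `F : (W₁, W₂) ↦ ℝ` with respect to all
(flattened) parameters. -/
noncomputable def gradWnorm {m d p : ℕ} (k : ℕ)
    (F : ((Fin m → Fin d → ℝ) × (Fin p → ℝ)) → ℝ)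
    (W : (Fin m → Fin d → ℝ) × (Fin p → ℝ)) : ℝ :=
  ((∑ r, ∑ s, |fderiv ℝ F W (Pi.single r (Pi.single s 1), 0)| ^ (2 * k))
    + ∑ l, |fderiv ℝ F W (0, Pi.single l 1)| ^ (2 * k)) ^ ((2 * k : ℝ))⁻¹

section Norms

variable {k m d p : ℕ}

lemma sum_abs_pow_nonneg (k : ℕ) (v : Fin d → ℝ) : 0 ≤ ∑ j, |v j| ^ (2 * k) :=
  Finset.sum_nonneg fun _ _ => by positivity

lemma lpnorm_nonneg (k : ℕ) (v : Fin d → ℝ) : 0 ≤ lpnorm k v :=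
  Real.rpow_nonneg (sum_abs_pow_nonneg k v) _

lemma pow_rpow_inv_two_mul (hk : 1 ≤ k) {a : ℝ} (ha : 0 ≤ a) :
    (a ^ (2 * k)) ^ ((2 * k : ℝ))⁻¹ = a := by
  have h := Real.pow_rpow_inv_natCast ha (n := 2 * k) (by omega)
  push_cast at h
  exact h

lemma abs_le_lpnorm (hk : 1 ≤ k) (v : Fin d → ℝ) (j : Fin d) : |v j| ≤ lpnorm k v := by
  rw [← pow_rpow_inv_two_mul hk (abs_nonneg (v j))]
  exact Real.rpow_le_rpow (by positivity)
    (Finset.single_le_sum (f := fun j => |v j| ^ (2 * k)) (fun _ _ => by positivity)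
      (Finset.mem_univ j)) (by positivity)

lemma lpnorm_mono {v w : Fin d → ℝ} (h : ∀ j, |v j| ≤ |w j|) : lpnorm k v ≤ lpnorm k w :=
  Real.rpow_le_rpow (sum_abs_pow_nonneg k v)
    (Finset.sum_le_sum fun j _ => pow_le_pow_left₀ (abs_nonneg _) (h j) _) (by positivity)

lemma lpnorm_smul (hk : 1 ≤ k) (c : ℝ) (v : Fin d → ℝ) :
    lpnorm k (c • v) = |c| * lpnorm k v := by
  unfold lpnorm
  simp only [Pi.smul_apply, smul_eq_mul, abs_mul, mul_pow]
  rw [← Finset.mul_sum, Real.mul_rpow (by positivity) (sum_abs_pow_nonneg k v),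
    pow_rpow_inv_two_mul hk (abs_nonneg c)]

lemma eq_zero_of_lpnorm_eq_zero (hk : 1 ≤ k) {v : Fin d → ℝ} (h : lpnorm k v = 0) : v = 0 := by
  funext j
  have := abs_le_lpnorm hk v j
  rw [h] at this
  exact abs_nonpos_iff.mp this

lemma lpnorm_pos (hk : 1 ≤ k) {v : Fin d → ℝ} (hv : v ≠ 0) : 0 < lpnorm k v :=
  lt_of_le_of_ne (lpnorm_nonneg k v) fun h => hv (eq_zero_of_lpnorm_eq_zero hk h.symm)

lemma lpnorm_zero (hk : 1 ≤ k) : lpnorm k (0 : Fin d → ℝ) = 0 := by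
  simpa using lpnorm_smul hk 0 (0 : Fin d → ℝ)

lemma mVec_add (W : Fin m → Fin d → ℝ) (x y : Fin d → ℝ) :
    mVec W (x + y) = mVec W x + mVec W y := by
  funext r
  simp [mVec, mul_add, Finset.sum_add_distrib]

lemma mVec_smul (W : Fin m → Fin d → ℝ) (c : ℝ) (x : Fin d → ℝ) :
    mVec W (c • x) = c • mVec W x := by
  funext r
  simp only [mVec, Pi.smul_apply, smul_eq_mul, Finset.mul_sum]
  exact Finset.sum_congr rfl fun _ _ => by ring

lemma mVec_zero (W : Fin m → Fin d → ℝ) : mVec W 0 = 0 := by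
  funext r
  simp [mVec]

lemma opNormP_bddAbove (hk : 1 ≤ k) (W : Fin m → Fin d → ℝ) :
    BddAbove {r : ℝ | ∃ x : Fin d → ℝ, lpnorm k x = 1 ∧ r = lpnorm k (mVec W x)} := by
  refine ⟨lpnorm k fun r => ∑ s, |W r s|, ?_⟩
  rintro _ ⟨x, hx, rfl⟩
  refine lpnorm_mono fun r => ?_
  rw [abs_of_nonneg (Finset.sum_nonneg fun s _ => abs_nonneg (W r s))]
  refine (Finset.abs_sum_le_sum_abs _ _).trans (Finset.sum_le_sum fun s _ => ?_)
  rw [abs_mul]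
  exact mul_le_of_le_one_right (abs_nonneg _) (hx ▸ abs_le_lpnorm hk x s)

lemma lpnorm_mVec_le (hk : 1 ≤ k) (W : Fin m → Fin d → ℝ) (x : Fin d → ℝ) :
    lpnorm k (mVec W x) ≤ opNormP k W * lpnorm k x := by
  by_cases hx : x = 0
  · simp [hx, mVec_zero, lpnorm_zero hk]
  have hpos := lpnorm_pos hk hx
  have h : lpnorm k (mVec W ((lpnorm k x)⁻¹ • x)) ≤ opNormP k W := by
    refine le_csSup (opNormP_bddAbove hk W) ⟨_, ?_, rfl⟩
    rw [lpnorm_smul hk, abs_of_pos (inv_pos.mpr hpos), inv_mul_cancel₀ hpos.ne']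
  rwa [mVec_smul, lpnorm_smul hk, abs_of_pos (inv_pos.mpr hpos), inv_mul_le_iff₀ hpos,
    mul_comm] at h

lemma opNormP_nonneg (k : ℕ) (W : Fin m → Fin d → ℝ) : 0 ≤ opNormP k W := by
  refine Real.sSup_nonneg ?_
  rintro _ ⟨x, -, rfl⟩
  exact lpnorm_nonneg _ _

lemma l2norm_eq_lpnorm_one (v : Fin d → ℝ) : l2norm v = lpnorm 1 v := by
  unfold l2norm lpnorm
  simp [Real.sqrt_eq_rpow]

lemma l2norm_nonneg (v : Fin d → ℝ) : 0 ≤ l2norm v := Real.sqrt_nonneg _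

lemma l2norm_mVec_le (W : Fin m → Fin d → ℝ) (x : Fin d → ℝ) :
    l2norm (mVec W x) ≤ opNorm2 W * l2norm x := by
  have h : opNorm2 W = opNormP 1 W := by simp only [opNorm2, opNormP, l2norm_eq_lpnorm_one]
  rw [h, l2norm_eq_lpnorm_one, l2norm_eq_lpnorm_one]
  exact lpnorm_mVec_le le_rfl W x

lemma l2norm_le_sqrt_mul_lpnorm (hk : 1 ≤ k) (v : Fin d → ℝ) :
    l2norm v ≤ √d * lpnorm k v := by
  rw [← Real.sqrt_sq (lpnorm_nonneg k v), ← Real.sqrt_mul (Nat.cast_nonneg d)]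
  refine Real.sqrt_le_sqrt ?_
  calc ∑ j, v j ^ 2 ≤ ∑ _j : Fin d, lpnorm k v ^ 2 := Finset.sum_le_sum fun j _ => by
        rw [← sq_abs]; exact pow_le_pow_left₀ (abs_nonneg _) (abs_le_lpnorm hk v j) 2
    _ = d * lpnorm k v ^ 2 := by simp

lemma abs_sum_mul_le_l2norm (a b : Fin d → ℝ) :
    |∑ j, a j * b j| ≤ l2norm a * l2norm b := by
  rw [l2norm, l2norm, ← Real.sqrt_mul (Finset.sum_nonneg fun _ _ => sq_nonneg _)]
  exact Real.abs_le_sqrt (Finset.sum_mul_sq_le_sq_mul_sq _ _ _)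

lemma sum_sq_mul_eq (u : Fin m → ℝ) (v : Fin d → ℝ) :
    √(∑ r, ∑ s, (u r * v s) ^ 2) = l2norm u * l2norm v := by
  rw [l2norm, l2norm, ← Real.sqrt_mul (Finset.sum_nonneg fun _ _ => sq_nonneg _),
    Finset.sum_mul_sum]
  simp only [mul_pow]

lemma linearMap_apply_eq_sum (L : (Fin d → ℝ) →L[ℝ] ℝ) (v : Fin d → ℝ) :
    L v = ∑ j, L (Pi.single j 1) * v j := by
  conv_lhs => rw [pi_eq_sum_univ' v]
  simp only [map_sum, map_smul, smul_eq_mul]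
  exact Finset.sum_congr rfl fun j _ => mul_comm _ _

/-- Mean value inequality along the segment from `x` to `x + v`. -/
lemma abs_sub_le_of_forall_segment {E : Type*} [NormedAddCommGroup E] [NormedSpace ℝ E]
    {f : E → ℝ} (hf : Differentiable ℝ f) (x v : E) {K : ℝ}
    (h : ∀ t ∈ Set.Icc (0 : ℝ) 1, |fderiv ℝ f (x + t • v) v| ≤ K) :
    |f (x + v) - f x| ≤ K := by
  have hd : ∀ t : ℝ, HasDerivAt (fun t : ℝ => f (x + t • v)) (fderiv ℝ f (x + t • v) v) t := by
    intro t
    have hl : HasDerivAt (fun t : ℝ => x + t • v) v t := by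
      simpa using ((hasDerivAt_id t).smul_const v).const_add x
    exact (hf _).hasFDerivAt.comp_hasDerivAt t hl
  have := norm_image_sub_le_of_norm_deriv_le_segment_01'
    (fun t _ => (hd t).hasDerivWithinAt) (C := K)
    (fun t ht => h t ⟨ht.1, ht.2.le⟩)
  simpa using this

end Norms

section Model

variable {k m d p : ℕ} {ft : (Fin m → ℝ) → (Fin p → ℝ) → ℝ}

/-- The linear map `(W₁, W₂) ↦ (W₁ x, W₂)`. -/
noncomputable def paramEval (x : Fin d → ℝ) :
    ((Fin m → Fin d → ℝ) × (Fin p → ℝ)) →L[ℝ] ((Fin m → ℝ) × (Fin p → ℝ)) :=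
  LinearMap.toContinuousLinearMap
    { toFun := fun V => (mVec V.1 x, V.2)
      map_add' := fun V V' => by
        ext r
        · simp [mVec, add_mul, Finset.sum_add_distrib]
        · simp
      map_smul' := fun c V => by
        ext r
        · simp [mVec, Finset.mul_sum, mul_assoc]
        · simp }

lemma paramEval_apply (x : Fin d → ℝ) (V : (Fin m → Fin d → ℝ) × (Fin p → ℝ)) :
    paramEval x V = (mVec V.1 x, V.2) := rfl

/-- The linear map `x ↦ W x`. -/
noncomputable def mVecCLM (W : Fin m → Fin d → ℝ) : (Fin d → ℝ) →L[ℝ] (Fin m → ℝ) :=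
  LinearMap.toContinuousLinearMap
    { toFun := mVec W
      map_add' := mVec_add W
      map_smul' := mVec_smul W }

/-- The gradient of `ft` in its first argument. -/
noncomputable def gradFst (ft : (Fin m → ℝ) → (Fin p → ℝ) → ℝ)
    (q : (Fin m → ℝ) × (Fin p → ℝ)) : Fin m → ℝ :=
  fun r => fderiv ℝ (fun q : (Fin m → ℝ) × (Fin p → ℝ) => ft q.1 q.2) q (Pi.single r 1, 0)

lemma fderiv_fst_apply_eq_sum (q : (Fin m → ℝ) × (Fin p → ℝ)) (v : Fin m → ℝ) :
    fderiv ℝ (fun q : (Fin m → ℝ) × (Fin p → ℝ) => ft q.1 q.2) q (v, 0)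
      = ∑ r, gradFst ft q r * v r := by
  have := linearMap_apply_eq_sum
    ((fderiv ℝ (fun q : (Fin m → ℝ) × (Fin p → ℝ) => ft q.1 q.2) q).comp
      (ContinuousLinearMap.inl ℝ _ _)) v
  simpa [gradFst] using this

lemma fderiv_param
    (hft : Differentiable ℝ (fun q : (Fin m → ℝ) × (Fin p → ℝ) => ft q.1 q.2))
    (x : Fin d → ℝ) (W V : (Fin m → Fin d → ℝ) × (Fin p → ℝ)) :
    fderiv ℝ (fun V : (Fin m → Fin d → ℝ) × (Fin p → ℝ) => ft (mVec V.1 x) V.2) W V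
      = fderiv ℝ (fun q : (Fin m → ℝ) × (Fin p → ℝ) => ft q.1 q.2)
          (mVec W.1 x, W.2) (mVec V.1 x, V.2) := by
  have h := (hft (paramEval x W)).hasFDerivAt.comp W (paramEval x).hasFDerivAt
  have h' := h.fderiv
  simp only [Function.comp_def, paramEval_apply] at h'
  rw [h']
  rfl

lemma hasFDerivAt_input
    (hft : Differentiable ℝ (fun q : (Fin m → ℝ) × (Fin p → ℝ) => ft q.1 q.2))
    (W : (Fin m → Fin d → ℝ) × (Fin p → ℝ)) (x : Fin d → ℝ) :
    HasFDerivAt (fun z => ft (mVec W.1 z) W.2)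
      ((fderiv ℝ (fun q : (Fin m → ℝ) × (Fin p → ℝ) => ft q.1 q.2) (mVec W.1 x, W.2)).comp
        ((mVecCLM W.1).prod 0)) x :=
  HasFDerivAt.comp (g := fun q : (Fin m → ℝ) × (Fin p → ℝ) => ft q.1 q.2) x
    (hft (mVec W.1 x, W.2)).hasFDerivAt ((mVecCLM W.1).hasFDerivAt.prodMk (hasFDerivAt_const W.2 x))

lemma lpnorm_gradFst_mul_lpnorm_le_gradWnorm
    (hft : Differentiable ℝ (fun q : (Fin m → ℝ) × (Fin p → ℝ) => ft q.1 q.2))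
    (x : Fin d → ℝ) (W : (Fin m → Fin d → ℝ) × (Fin p → ℝ)) :
    lpnorm k (gradFst ft (mVec W.1 x, W.2)) * lpnorm k x
      ≤ gradWnorm k (fun V => ft (mVec V.1 x) V.2) W := by
  have key : ∀ (r : Fin m) (s : Fin d),
      fderiv ℝ (fun V : (Fin m → Fin d → ℝ) × (Fin p → ℝ) => ft (mVec V.1 x) V.2) W
        (Pi.single r (Pi.single s 1), 0) = gradFst ft (mVec W.1 x, W.2) r * x s := by
    intro r s
    have hv : mVec (Pi.single r (Pi.single s 1)) x = x s • (Pi.single r 1 : Fin m → ℝ) := by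
      funext r'
      by_cases h : r' = r
      · subst h
        simp [mVec, Pi.single_apply]
      · simp [mVec, h]
    rw [fderiv_param hft]
    dsimp only
    rw [hv, fderiv_fst_apply_eq_sum]
    simp [Pi.single_apply]
  unfold lpnorm gradWnorm
  rw [← Real.mul_rpow (sum_abs_pow_nonneg k _) (sum_abs_pow_nonneg k _), Finset.sum_mul_sum]
  refine Real.rpow_le_rpow (by positivity) ?_ (by positivity)
  simp only [key, abs_mul, mul_pow]
  exact le_add_of_nonneg_right (Finset.sum_nonneg fun _ _ => by positivity)

/-- The gradient of the model in its input is `W₁ᵀ` applied to the gradient of `ft` in its first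
argument. -/
lemma abs_fderiv_input_le (hk : 1 ≤ k) (W : Fin m → Fin d → ℝ)
    (q : (Fin m → ℝ) × (Fin p → ℝ)) (v : Fin d → ℝ) :
    |fderiv ℝ (fun q : (Fin m → ℝ) × (Fin p → ℝ) => ft q.1 q.2) q (mVec W v, 0)|
      ≤ √d * (opNormP k (fun s r => W r s) * lpnorm k (gradFst ft q)) * l2norm v := by
  have h : ∑ r, gradFst ft q r * mVec W v r
      = ∑ s, mVec (fun s r => W r s) (gradFst ft q) s * v s := by
    simp only [mVec, Finset.mul_sum, Finset.sum_mul]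
    rw [Finset.sum_comm]
    exact Finset.sum_congr rfl fun _ _ => Finset.sum_congr rfl fun _ _ => by ring
  rw [fderiv_fst_apply_eq_sum, h]
  refine (abs_sum_mul_le_l2norm _ _).trans ?_
  refine mul_le_mul_of_nonneg_right ?_ (l2norm_nonneg v)
  exact (l2norm_le_sqrt_mul_lpnorm hk _).trans
    (mul_le_mul_of_nonneg_left (lpnorm_mVec_le hk _ _) (Real.sqrt_nonneg _))

/-- A perturbation of the input can be absorbed in a rank-one perturbation of the first layer. -/
lemma exists_param_of_input_perturbation {x : Fin d → ℝ} (hx : x ≠ 0)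
    (W : (Fin m → Fin d → ℝ) × (Fin p → ℝ)) (v : Fin d → ℝ) :
    ∃ W' : (Fin m → Fin d → ℝ) × (Fin p → ℝ), mVec W'.1 x = mVec W.1 (x + v) ∧ W'.2 = W.2 ∧
      paramDist W' W ≤ opNorm2 W.1 * l2norm v / l2norm x := by
  have hpos : 0 < l2norm x := l2norm_eq_lpnorm_one x ▸ lpnorm_pos le_rfl hx
  have hsq : ∑ s, x s ^ 2 = l2norm x ^ 2 :=
    (Real.sq_sqrt (Finset.sum_nonneg fun _ _ => sq_nonneg _)).symm
  refine ⟨(fun r s => W.1 r s + mVec W.1 v r * ((l2norm x ^ 2)⁻¹ • x) s, W.2), ?_, rfl, ?_⟩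
  · rw [mVec_add]
    funext r
    have : ∀ s, (W.1 r s + mVec W.1 v r * ((l2norm x ^ 2)⁻¹ • x) s) * x s
        = W.1 r s * x s + mVec W.1 v r * (l2norm x ^ 2)⁻¹ * x s ^ 2 := fun s => by
      simp only [Pi.smul_apply, smul_eq_mul]; ring
    change ∑ s, (W.1 r s + mVec W.1 v r * ((l2norm x ^ 2)⁻¹ • x) s) * x s
      = ∑ s, W.1 r s * x s + mVec W.1 v r
    simp only [this]
    rw [Finset.sum_add_distrib, ← Finset.mul_sum, hsq, mul_assoc,
      inv_mul_cancel₀ (pow_pos hpos 2).ne', mul_one]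
  · simp only [paramDist, add_sub_cancel_left, sub_self, ne_eq, OfNat.ofNat_ne_zero,
      not_false_eq_true, zero_pow, Finset.sum_const_zero, add_zero]
    rw [sum_sq_mul_eq, l2norm_eq_lpnorm_one ((l2norm x ^ 2)⁻¹ • x), lpnorm_smul le_rfl,
      ← l2norm_eq_lpnorm_one, abs_of_pos (by positivity), le_div_iff₀ hpos]
    have : l2norm (mVec W.1 v) * ((l2norm x ^ 2)⁻¹ * l2norm x) * l2norm x
        = l2norm (mVec W.1 v) := by field_simp
    rw [this]
    exact l2norm_mVec_le _ _

/-- Local Lipschitz bound in the input from a bound on the parameter gradient norm near `W`. -/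
lemma abs_model_sub_le (hk : 1 ≤ k)
    (hft : Differentiable ℝ (fun q : (Fin m → ℝ) × (Fin p → ℝ) => ft q.1 q.2))
    {x : Fin d → ℝ} (hx : x ≠ 0) (W : (Fin m → Fin d → ℝ) × (Fin p → ℝ)) {ρ G : ℝ}
    (hG : ∀ W', paramDist W' W ≤ ρ → gradWnorm k (fun V => ft (mVec V.1 x) V.2) W' ≤ G)
    (v : Fin d → ℝ) (hρ : opNorm2 W.1 * l2norm v / l2norm x ≤ ρ) :
    |ft (mVec W.1 (x + v)) W.2 - ft (mVec W.1 x) W.2|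
      ≤ √d * (opNormP k (fun s r => W.1 r s) * (G / lpnorm k x)) * l2norm v := by
  refine abs_sub_le_of_forall_segment (f := fun z => ft (mVec W.1 z) W.2)
    (fun z => (hasFDerivAt_input hft W z).differentiableAt) x v fun t ht => ?_
  rw [(hasFDerivAt_input hft W _).fderiv]
  refine (abs_fderiv_input_le hk W.1 (mVec W.1 (x + t • v), W.2) v).trans ?_
  refine mul_le_mul_of_nonneg_right (mul_le_mul_of_nonneg_left
    (mul_le_mul_of_nonneg_left ?_ (opNormP_nonneg _ _)) (Real.sqrt_nonneg _)) (l2norm_nonneg v)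
  obtain ⟨W', h1, h2, h3⟩ := exists_param_of_input_perturbation hx W (t • v)
  rw [le_div_iff₀ (lpnorm_pos hk hx), ← h1, ← h2]
  refine (lpnorm_gradFst_mul_lpnorm_le_gradWnorm hft x W').trans (hG W' (h3.trans (le_trans ?_ hρ)))
  have hop : 0 ≤ opNorm2 W.1 := by
    refine Real.sSup_nonneg ?_
    rintro _ ⟨y, -, rfl⟩
    exact l2norm_nonneg _
  have htv : l2norm (t • v) ≤ l2norm v := by
    rw [l2norm_eq_lpnorm_one, lpnorm_smul le_rfl, ← l2norm_eq_lpnorm_one, abs_of_nonneg ht.1]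
    exact mul_le_of_le_one_left (l2norm_nonneg v) ht.2
  have := l2norm_nonneg x
  gcongr

lemma abs_sub_le_of_gradient_bound {f : (Fin d → ℝ) → ℝ} (hf : Differentiable ℝ f) {M : ℝ}
    (hM : ∀ z, l2norm (fun j => fderiv ℝ f z (Pi.single j 1)) ≤ M) (x v : Fin d → ℝ) :
    |f (x + v) - f x| ≤ M * l2norm v := by
  refine abs_sub_le_of_forall_segment hf x v fun t _ => ?_
  rw [linearMap_apply_eq_sum]
  exact (abs_sum_mul_le_l2norm _ v).trans
    (mul_le_mul_of_nonneg_right (hM _) (l2norm_nonneg v))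

/-- Moment bounds in every coordinate control the parameter gradient norm at each sample. -/
lemma gradWnorm_le_of_moment {n B : ℕ} (hn : 0 < n) (hk : 1 ≤ k) (hB : 1 ≤ B) {η : ℝ}
    (hη : 0 < η) (F : Fin n → ((Fin m → Fin d → ℝ) × (Fin p → ℝ)) → ℝ)
    (W : (Fin m → Fin d → ℝ) × (Fin p → ℝ))
    (h1 : ∀ (r : Fin m) (s : Fin d),
      (1 / (n : ℝ)) * ∑ i, (fderiv ℝ (F i) W (Pi.single r (Pi.single s 1), 0)) ^ (2 * k)
        ≤ 2 ^ k * (B : ℝ) ^ (k - 1) / η ^ k)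
    (h2 : ∀ l : Fin p,
      (1 / (n : ℝ)) * ∑ i, (fderiv ℝ (F i) W (0, Pi.single l 1)) ^ (2 * k)
        ≤ 2 ^ k * (B : ℝ) ^ (k - 1) / η ^ k) (i : Fin n) :
    gradWnorm k (F i) W
      ≤ (2 * (n : ℝ) * ((m * d + p : ℕ) : ℝ) / (B : ℝ)) ^ ((2 * k : ℝ))⁻¹ *
          Real.sqrt (2 * (B : ℝ) / η) := by
  have hB0 : (0 : ℝ) < B := by exact_mod_cast hB
  have hn0 : (0 : ℝ) < n := by exact_mod_cast hn
  have hK : (2 : ℝ) ^ k * (B : ℝ) ^ (k - 1) / η ^ k = (2 * B / η) ^ k / B := by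
    obtain ⟨j, rfl⟩ : ∃ j, k = j + 1 := ⟨k - 1, by omega⟩
    rw [div_pow, mul_pow, Nat.add_sub_cancel, pow_succ (B : ℝ)]
    field_simp
  rw [hK] at h1 h2
  set K : ℝ := (2 * B / η) ^ k / B with hKdef
  have hKpos : 0 ≤ K := by positivity
  have single : ∀ a : Fin n → ℝ, (1 / (n : ℝ)) * ∑ i, a i ^ (2 * k) ≤ K →
      |a i| ^ (2 * k) ≤ n * K := by
    intro a ha
    rw [one_div, inv_mul_le_iff₀ hn0] at ha
    rw [(even_two_mul k).pow_abs]
    exact (Finset.single_le_sum (f := fun i => a i ^ (2 * k))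
      (fun i _ => (even_two_mul k).pow_nonneg _) (Finset.mem_univ i)).trans ha
  have hs : √(2 * B / η) = ((2 * B / η) ^ k) ^ ((2 * k : ℝ))⁻¹ := by
    have h := pow_rpow_inv_two_mul hk (Real.sqrt_nonneg (2 * B / η))
    rw [pow_mul, Real.sq_sqrt (by positivity)] at h
    exact h.symm
  rw [hs, ← Real.mul_rpow (by positivity) (by positivity)]
  unfold gradWnorm
  refine Real.rpow_le_rpow (by positivity) ?_ (by positivity)
  calc _ ≤ (∑ _r : Fin m, ∑ _s : Fin d, n * K) + ∑ _l : Fin p, n * K :=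
        add_le_add
          (Finset.sum_le_sum fun r _ => Finset.sum_le_sum fun s _ => single _ (h1 r s))
          (Finset.sum_le_sum fun l _ => single _ (h2 l))
    _ = n * ((m * d + p : ℕ) : ℝ) * K := by
        simp only [Finset.sum_const, Finset.card_univ, Fintype.card_fin, nsmul_eq_mul]
        push_cast
        ring
    _ ≤ 2 * (n * ((m * d + p : ℕ) : ℝ) * K) := by
        have : 0 ≤ n * ((m * d + p : ℕ) : ℝ) * K := by positivity
        linarith
    _ = _ := by rw [hKdef]; ring

end Model

/-- A bounded measurable function which is at most `a` off a set of measure less than `ε` and at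
most `b` on that set has integral at most `a + b * ε`. -/
lemma integral_le_add_mul_of_measure_lt {α : Type*} [MeasurableSpace α] {μ : Measure α}
    [IsProbabilityMeasure μ] {g : α → ℝ} (hg : Integrable g μ) {s : Set α} (hs : MeasurableSet s)
    {a b ε : ℝ} (ha : 0 ≤ a) (hb : 0 ≤ b) (hμ : μ s < ENNReal.ofReal ε)
    (hgood : ∀ z ∉ s, g z ≤ a) (hbad : ∀ z, g z ≤ b) : ∫ z, g z ∂μ ≤ a + b * ε := by
  have hε : 0 < ε := ENNReal.ofReal_pos.mp (bot_le.trans_lt hμ)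
  have hle : μ.real s ≤ ε := ENNReal.toReal_le_of_le_ofReal hε.le hμ.le
  have hint : Integrable (fun z => a + s.indicator (fun _ => b) z) μ :=
    (integrable_const a).add ((integrable_const b).indicator hs)
  calc ∫ z, g z ∂μ ≤ ∫ z, (a + s.indicator (fun _ => b) z) ∂μ := by
        refine integral_mono hg hint fun z => ?_
        by_cases hz : z ∈ s
        · simpa [hz] using (hbad z).trans (le_add_of_nonneg_left ha)
        · simpa [hz] using hgood z hz
    _ = a + μ.real s * b := by
        rw [integral_add (integrable_const a) ((integrable_const b).indicator hs),
          integral_indicator_const b hs]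
        simp
    _ ≤ a + b * ε := by nlinarith

/-- generalization error bound for a stable interpolation solution found by
SGD, under the covered condition of the data distribution, local smoothness, and boundedness
of model and target. -/
theorem generalization_error_bound
    {m d p n : ℕ} (hn : 0 < n) (B k : ℕ) (hk : 1 ≤ k) (hB : 1 ≤ B)
    (η : ℝ) (hη : 0 < η)
    (C δa δ ε₂ M₁ M₂ : ℝ) (hC : 0 < C) (hδa : 0 < δa) (hδ : 0 < δ)
    (μ : Measure (Fin d → ℝ)) [IsProbabilityMeasure μ]
    (fstar : (Fin d → ℝ) → ℝ) (hfstar : Differentiable ℝ fstar)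
    (ft : (Fin m → ℝ) → (Fin p → ℝ) → ℝ)
    (hft : Differentiable ℝ (fun q : (Fin m → ℝ) × (Fin p → ℝ) => ft q.1 q.2))
    (x : Fin n → Fin d → ℝ) (hx : ∀ i, x i ≠ 0)
    (Wstar : (Fin m → Fin d → ℝ) × (Fin p → ℝ))
    (hinterp : ∀ i, ft (mVec Wstar.1 (x i)) Wstar.2 = fstar (x i))
    -- (i) the stability moment bounds in every parameter coordinate
    (hmom1 : ∀ (r : Fin m) (s : Fin d),
      (1 / (n : ℝ)) * ∑ i,
          (fderiv ℝ (fun V : (Fin m → Fin d → ℝ) × (Fin p → ℝ) => ft (mVec V.1 (x i)) V.2)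
            Wstar (Pi.single r (Pi.single s 1), 0)) ^ (2 * k)
        ≤ 2 ^ k * (B : ℝ) ^ (k - 1) / η ^ k)
    (hmom2 : ∀ l : Fin p,
      (1 / (n : ℝ)) * ∑ i,
          (fderiv ℝ (fun V : (Fin m → Fin d → ℝ) × (Fin p → ℝ) => ft (mVec V.1 (x i)) V.2)
            Wstar (0, Pi.single l 1)) ^ (2 * k)
        ≤ 2 ^ k * (B : ℝ) ^ (k - 1) / η ^ k)
    -- (ii) local smoothness at each training point, with δ_approx large enough
    (hsmooth : ∀ i, ∀ W' : (Fin m → Fin d → ℝ) × (Fin p → ℝ), paramDist W' Wstar ≤ δa →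
      gradWnorm k (fun V => ft (mVec V.1 (x i)) V.2) W'
        ≤ C * (gradWnorm k (fun V => ft (mVec V.1 (x i)) V.2) Wstar + 1))
    (hδa_large : δa ≥ δ * opNorm2 Wstar.1 /
      (Finset.univ.inf' ⟨⟨0, hn⟩, Finset.mem_univ _⟩ fun i => l2norm (x i)))
    -- (iii) the training set (δ, ε₂)-covers μ
    (hcover : μ {z | ∀ i, δ < l2norm (fun t => z t - x i t)} < ENNReal.ofReal ε₂)
    -- (iv) boundedness of model, target, and target gradient
    (hM₁f : ∀ z, |ft (mVec Wstar.1 z) Wstar.2| ≤ M₁)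
    (hM₁fstar : ∀ z, |fstar z| ≤ M₁)
    (hM₂ : ∀ z, l2norm (fun j => fderiv ℝ fstar z (Pi.single j 1)) ≤ M₂) :
    ∫ z, (ft (mVec Wstar.1 z) Wstar.2 - fstar z) ^ 2 ∂μ
      ≤ 2 * (d : ℝ) * C ^ 2 * (opNormP k (fun s r => Wstar.1 r s)) ^ 2 /
            (Finset.univ.inf' ⟨⟨0, hn⟩, Finset.mem_univ _⟩ fun i => lpnorm k (x i)) ^ 2 *
          ((2 * (n : ℝ) * ((m * d + p : ℕ) : ℝ) / (B : ℝ)) ^ ((2 * k : ℝ))⁻¹ *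
              Real.sqrt (2 * (B : ℝ) / η) + 1) ^ 2 * δ ^ 2
        + 2 * M₂ ^ 2 * δ ^ 2 + 4 * M₁ ^ 2 * ε₂ := by
  set hne : (Finset.univ : Finset (Fin n)).Nonempty := ⟨⟨0, hn⟩, Finset.mem_univ _⟩
  set A := opNormP k (fun s r => Wstar.1 r s) with hA
  set D := Finset.univ.inf' hne fun i => lpnorm k (x i) with hD
  set Q := (2 * (n : ℝ) * ((m * d + p : ℕ) : ℝ) / (B : ℝ)) ^ ((2 * k : ℝ))⁻¹ *
    Real.sqrt (2 * (B : ℝ) / η) + 1 with hQ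
  have hA0 : 0 ≤ A := opNormP_nonneg _ _
  have hQ0 : 0 ≤ Q := by positivity
  have hDpos : 0 < D := (Finset.lt_inf'_iff hne).mpr fun i _ => lpnorm_pos hk (hx i)
  have hl2pos : ∀ i, 0 < l2norm (x i) := fun i =>
    l2norm_eq_lpnorm_one (x i) ▸ lpnorm_pos le_rfl (hx i)
  have hop : 0 ≤ opNorm2 Wstar.1 := by
    refine Real.sSup_nonneg ?_
    rintro _ ⟨y, -, rfl⟩
    exact l2norm_nonneg _
  have hM₁ : 0 ≤ M₁ := (abs_nonneg _).trans (hM₁fstar 0)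
  have hM₂0 : 0 ≤ M₂ := (l2norm_nonneg _).trans (hM₂ 0)
  have hfcont : Continuous fun z => ft (mVec Wstar.1 z) Wstar.2 :=
    Differentiable.continuous (𝕜 := ℝ) fun z => (hasFDerivAt_input hft Wstar z).differentiableAt
  have hcont : Continuous fun z => (ft (mVec Wstar.1 z) Wstar.2 - fstar z) ^ 2 :=
    (hfcont.sub hfstar.continuous).pow 2
  have hbad : ∀ z, (ft (mVec Wstar.1 z) Wstar.2 - fstar z) ^ 2 ≤ 4 * M₁ ^ 2 := by
    intro z
    have h1 := abs_le.mp (hM₁f z)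
    have h2 := abs_le.mp (hM₁fstar z)
    have : |ft (mVec Wstar.1 z) Wstar.2 - fstar z| ≤ 2 * M₁ :=
      abs_le.mpr ⟨by linarith, by linarith⟩
    calc _ = |ft (mVec Wstar.1 z) Wstar.2 - fstar z| ^ 2 := (sq_abs _).symm
      _ ≤ (2 * M₁) ^ 2 := pow_le_pow_left₀ (abs_nonneg _) this 2
      _ = 4 * M₁ ^ 2 := by ring
  have hint : Integrable (fun z => (ft (mVec Wstar.1 z) Wstar.2 - fstar z) ^ 2) μ := by
    refine Integrable.of_bound hcont.aestronglyMeasurable (4 * M₁ ^ 2) (.of_forall fun z => ?_)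
    rw [Real.norm_of_nonneg (sq_nonneg _)]
    exact hbad z
  have hmeas : MeasurableSet {z : Fin d → ℝ | ∀ i, δ < l2norm (fun t => z t - x i t)} := by
    rw [Set.ofPred_forall]
    refine MeasurableSet.iInter fun i => IsOpen.measurableSet (isOpen_lt continuous_const ?_)
    unfold l2norm
    fun_prop
  refine integral_le_add_mul_of_measure_lt hint hmeas (by positivity) (by positivity) hcover
    (fun z hz => ?_) hbad
  simp only [Set.mem_ofPred_eq, not_forall, not_lt] at hz
  obtain ⟨i, hi⟩ := hz
  set v : Fin d → ℝ := fun t => z t - x i t with hv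
  have hz : z = x i + v := by
    funext t
    simp [hv]
  have hρ : opNorm2 Wstar.1 * l2norm v / l2norm (x i) ≤ δa := by
    refine le_trans ?_ hδa_large
    rw [mul_comm δ]
    exact div_le_div₀ (by positivity) (mul_le_mul_of_nonneg_left hi hop)
      ((Finset.lt_inf'_iff hne).mpr fun i _ => hl2pos i)
      (Finset.inf'_le _ (Finset.mem_univ i))
  have hG : ∀ W', paramDist W' Wstar ≤ δa →
      gradWnorm k (fun V => ft (mVec V.1 (x i)) V.2) W' ≤ C * Q := fun W' hW' =>
    (hsmooth i W' hW').trans (mul_le_mul_of_nonneg_left (add_le_add_left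
      (gradWnorm_le_of_moment hn hk hB hη
        (fun i V => ft (mVec V.1 (x i)) V.2) Wstar hmom1 hmom2 i) 1) hC.le)
  have hmodel : |ft (mVec Wstar.1 z) Wstar.2 - ft (mVec Wstar.1 (x i)) Wstar.2|
      ≤ √d * (A * (C * Q / D)) * δ := by
    rw [hz]
    refine (abs_model_sub_le hk hft (hx i) Wstar hG v hρ).trans ?_
    have : D ≤ lpnorm k (x i) := Finset.inf'_le _ (Finset.mem_univ i)
    have := l2norm_nonneg v
    gcongr
  have htarget : |fstar z - fstar (x i)| ≤ M₂ * δ := by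
    rw [hz]
    exact (abs_sub_le_of_gradient_bound hfstar hM₂ (x i) v).trans
      (mul_le_mul_of_nonneg_left hi hM₂0)
  have hsq1 := pow_le_pow_left₀ (abs_nonneg _) hmodel 2
  have hsq2 := pow_le_pow_left₀ (abs_nonneg _) htarget 2
  rw [sq_abs] at hsq1 hsq2
  have hd : √(d : ℝ) ^ 2 = d := Real.sq_sqrt (Nat.cast_nonneg d)
  calc (ft (mVec Wstar.1 z) Wstar.2 - fstar z) ^ 2
      = ((ft (mVec Wstar.1 z) Wstar.2 - ft (mVec Wstar.1 (x i)) Wstar.2)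
          - (fstar z - fstar (x i))) ^ 2 := by rw [hinterp i]; ring
    _ ≤ 2 * (√d * (A * (C * Q / D)) * δ) ^ 2 + 2 * (M₂ * δ) ^ 2 := by
        nlinarith [sq_nonneg ((ft (mVec Wstar.1 z) Wstar.2 - ft (mVec Wstar.1 (x i)) Wstar.2)
          + (fstar z - fstar (x i)))]
    _ = _ := by
        simp only [mul_pow, div_pow, hd]
        ring
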